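/- Let (g, [·,·], α, β) be a nonmultiplicative BiHom-Lie superalgebra over a field K and let τ : g → K be an even linear form satisfying τ([x,y]) = 0, τ(x)τ(β(y)) = τ(y)τ(β(x)), and τ(α(x))β(y) = τ(β(x))α(y) for all x, y. Then the induced 3-ary bracket [x₁,x₂,x₃]_τ = τ(x₁)[x₂,x₃] - (-1)^{|x₁||x₂|}τ(x₂)[x₁,x₃] + (-1)^{|x₃|(|x₁|+|x₂|)}τ(x₃)[x₁,x₂] satisfies, for all homogeneous x₁, x₂, x₃: [β(x₁),β(x₂),α(x₃)]_τ = -(-1)^{|x₁||x₂|}[β(x₂),β(x₁),α(x₃)]_τ and [β(x₁),β(x₂),α(x₃)]_τ = -(-1)^{|x₂||x₃|}[β(x₁),β(x₃),α(x₂)]_τ. -/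

import Mathlib

namespace BiHomLieSuper

/-- The sign `(-1)^n` for a parity `n : ZMod 2`. -/
def sg (K : Type*) [Field K] (n : ZMod 2) : K := if n = 0 then 1 else -1

variable (K : Type*) {V : Type*} [Field K] [AddCommGroup V] [Module K V]

/-- `f : V → V → V` is bilinear. -/
structure IsBilinear (f : V → V → V) : Prop where
  add_left : ∀ x x' y : V, f (x + x') y = f x y + f x' y
  smul_left : ∀ (c : K) (x y : V), f (c • x) y = c • f x y
  add_right : ∀ x y y' : V, f x (y + y') = f x y + f x y'
  smul_right : ∀ (c : K) (x y : V), f x (c • y) = c • f x y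

/-- `f : V → V → V → V` is trilinear. -/
structure IsTrilinear (f : V → V → V → V) : Prop where
  add₁ : ∀ x x' y z : V, f (x + x') y z = f x y z + f x' y z
  smul₁ : ∀ (c : K) (x y z : V), f (c • x) y z = c • f x y z
  add₂ : ∀ x y y' z : V, f x (y + y') z = f x y z + f x y' z
  smul₂ : ∀ (c : K) (x y z : V), f x (c • y) z = c • f x y z
  add₃ : ∀ x y z z' : V, f x y (z + z') = f x y z + f x y z'
  smul₃ : ∀ (c : K) (x y z : V), f x y (c • z) = c • f x y z

/-- An even linear map preserves the `ZMod 2`-grading. -/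
def IsEvenMap (G : ZMod 2 → Submodule K V) (φ : Module.End K V) : Prop :=
  ∀ (i : ZMod 2), ∀ x ∈ G i, φ x ∈ G i

/-- A homogeneous linear map of degree `d` with respect to the grading `G`. -/
def IsHomogeneousMap (G : ZMod 2 → Submodule K V) (d : ZMod 2) (D : Module.End K V) : Prop :=
  ∀ (i : ZMod 2), ∀ x ∈ G i, D x ∈ G (i + d)

/-- A nonmultiplicative BiHom-Lie superalgebra structure on the `ZMod 2`-graded
vector space `V` (grading `G`), with bracket `br` and structure maps `α`, `β`. -/
structure IsNonMultBiHomLieSuperalgebra (G : ZMod 2 → Submodule K V)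
    (br : V → V → V) (α β : Module.End K V) : Prop where
  internal : DirectSum.IsInternal G
  bilinear : IsBilinear K br
  br_even : ∀ (i j : ZMod 2), ∀ x ∈ G i, ∀ y ∈ G j, br x y ∈ G (i + j)
  alpha_even : IsEvenMap K G α
  beta_even : IsEvenMap K G β
  skew : ∀ (i j : ZMod 2), ∀ x ∈ G i, ∀ y ∈ G j,
    br (β x) (α y) = - sg K (i * j) • br (β y) (α x)
  jacobi : ∀ (i j k : ZMod 2), ∀ x ∈ G i, ∀ y ∈ G j, ∀ z ∈ G k,
    sg K (i * k) • br (β (β x)) (br (β y) (α z))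
      + sg K (j * i) • br (β (β y)) (br (β z) (α x))
      + sg K (k * j) • br (β (β z)) (br (β x) (α y)) = 0

/-- A (multiplicative) BiHom-Lie superalgebra. -/
structure IsBiHomLieSuperalgebra (G : ZMod 2 → Submodule K V)
    (br : V → V → V) (α β : Module.End K V)
    extends IsNonMultBiHomLieSuperalgebra K G br α β : Prop where
  comm : α * β = β * α
  alpha_br : ∀ x y : V, α (br x y) = br (α x) (α y)
  beta_br : ∀ x y : V, β (br x y) = br (β x) (β y)

/-- A nonmultiplicative 3-BiHom-Lie superalgebra structure. -/
structure IsNonMult3BiHomLieSuperalgebra (G : ZMod 2 → Submodule K V)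
    (br : V → V → V → V) (α β : Module.End K V) : Prop where
  internal : DirectSum.IsInternal G
  trilinear : IsTrilinear K br
  br_even : ∀ (i j k : ZMod 2), ∀ x ∈ G i, ∀ y ∈ G j, ∀ z ∈ G k, br x y z ∈ G (i + j + k)
  alpha_even : IsEvenMap K G α
  beta_even : IsEvenMap K G β
  skew₁ : ∀ (i j k : ZMod 2), ∀ x ∈ G i, ∀ y ∈ G j, ∀ z ∈ G k,
    br (β x) (β y) (α z) = - sg K (i * j) • br (β y) (β x) (α z)
  skew₂ : ∀ (i j k : ZMod 2), ∀ x ∈ G i, ∀ y ∈ G j, ∀ z ∈ G k,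
    br (β x) (β y) (α z) = - sg K (j * k) • br (β x) (β z) (α y)
  jacobi : ∀ (i j k l m : ZMod 2), ∀ x ∈ G i, ∀ y ∈ G j, ∀ z ∈ G k, ∀ u ∈ G l, ∀ v ∈ G m,
    br (β (β x)) (β (β y)) (br (β z) (β u) (α v))
      = sg K ((l + m) * (i + j + k)) • br (β (β u)) (β (β v)) (br (β x) (β y) (α z))
        - sg K ((k + m) * (i + j) + l * m) • br (β (β z)) (β (β v)) (br (β x) (β y) (α u))
        + sg K ((k + l) * (i + j)) • br (β (β z)) (β (β u)) (br (β x) (β y) (α v))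

/-- A (multiplicative) 3-BiHom-Lie superalgebra. -/
structure Is3BiHomLieSuperalgebra (G : ZMod 2 → Submodule K V)
    (br : V → V → V → V) (α β : Module.End K V)
    extends IsNonMult3BiHomLieSuperalgebra K G br α β : Prop where
  comm : α * β = β * α
  alpha_br : ∀ x y z : V, α (br x y z) = br (α x) (α y) (α z)
  beta_br : ∀ x y z : V, β (br x y z) = br (β x) (β y) (β z)

/-- A 3-Lie superalgebra structure (no structure maps). -/
structure Is3LieSuperalgebra (G : ZMod 2 → Submodule K V)
    (br : V → V → V → V) : Prop where
  internal : DirectSum.IsInternal G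
  trilinear : IsTrilinear K br
  br_even : ∀ (i j k : ZMod 2), ∀ x ∈ G i, ∀ y ∈ G j, ∀ z ∈ G k, br x y z ∈ G (i + j + k)
  skew₁ : ∀ (i j k : ZMod 2), ∀ x ∈ G i, ∀ y ∈ G j, ∀ z ∈ G k,
    br x y z = - sg K (i * j) • br y x z
  skew₂ : ∀ (i j k : ZMod 2), ∀ x ∈ G i, ∀ y ∈ G j, ∀ z ∈ G k,
    br x y z = - sg K (j * k) • br x z y
  jacobi : ∀ (i j k l m : ZMod 2), ∀ x ∈ G i, ∀ y ∈ G j, ∀ z ∈ G k, ∀ u ∈ G l, ∀ v ∈ G m,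
    br x y (br z u v) = br (br x y z) u v + sg K (k * (i + j)) • br z (br x y u) v
      + sg K ((k + l) * (i + j)) • br z u (br x y v)

/-- The compatibility conditions on the even linear form `τ` used to induce a
ternary bracket from a binary one: `τ` vanishes on the odd part, `τ([x,y]) = 0`,
`τ(x)τ(β(y)) = τ(y)τ(β(x))` and `τ(α(x))β(y) = τ(β(x))α(y)`. -/
def TauCompatible (G : ZMod 2 → Submodule K V) (br : V → V → V)
    (α β : Module.End K V) (τ : V →ₗ[K] K) : Prop :=
  (∀ x ∈ G 1, τ x = 0) ∧ (∀ x y : V, τ (br x y) = 0) ∧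
  (∀ x y : V, τ x * τ (β y) = τ y * τ (β x)) ∧
  (∀ x y : V, τ (α x) • β y = τ (β x) • α y)

/-- `brτ` is the trilinear bracket induced by `τ` from the binary bracket `br`:
on homogeneous elements it is given by
`[x,y,z]_τ = τ(x)[y,z] - (-1)^{|x||y|} τ(y)[x,z] + (-1)^{|z|(|x|+|y|)} τ(z)[x,y]`. -/
def IsInducedBracket (G : ZMod 2 → Submodule K V) (br : V → V → V)
    (τ : V →ₗ[K] K) (brτ : V → V → V → V) : Prop :=
  IsTrilinear K brτ ∧
  ∀ (i j k : ZMod 2), ∀ x ∈ G i, ∀ y ∈ G j, ∀ z ∈ G k,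
    brτ x y z = τ x • br y z - (sg K (i * j) * τ y) • br x z
      + (sg K (k * (i + j)) * τ z) • br x y

/-- The Rota-Baxter identity of weight `lam` for a binary bracket. -/
def IsRotaBaxter₂ (br : V → V → V) (lam : K) (R : Module.End K V) : Prop :=
  ∀ x y : V, br (R x) (R y) = R (br (R x) y + br x (R y) + lam • br x y)

/-- The Rota-Baxter identity of weight `lam` for a ternary bracket. -/
def IsRotaBaxter₃ (br : V → V → V → V) (lam : K) (R : Module.End K V) : Prop :=
  ∀ x y z : V,
    br (R x) (R y) (R z)
      = R (br (R x) (R y) z + br (R x) y (R z) + br x (R y) (R z)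
          + lam • br (R x) y z + lam • br x (R y) z + lam • br x y (R z)
          + lam ^ 2 • br x y z)

/-- The Nijenhuis identity for a binary bracket. -/
def IsNijenhuis₂ (br : V → V → V) (N : Module.End K V) : Prop :=
  ∀ x y : V, br (N x) (N y) = N (br (N x) y + br x (N y) - N (br x y))

/-- The Nijenhuis identity for a ternary bracket. -/
def IsNijenhuis₃ (br : V → V → V → V) (N : Module.End K V) : Prop :=
  ∀ x y z : V,
    br (N x) (N y) (N z)
      = N (br (N x) (N y) z + br (N x) y (N z) + br x (N y) (N z))
        - N (N (br (N x) y z + br x (N y) z + br x y (N z)))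
        + N (N (N (br x y z)))

/-- `D` is an `(α^s, β^r)`-derivation of degree `d` of the binary bracket `br`. -/
def IsAlphaBetaDeriv₂ (G : ZMod 2 → Submodule K V) (br : V → V → V)
    (α β : Module.End K V) (s r : ℕ) (d : ZMod 2) (D : Module.End K V) : Prop :=
  D * α = α * D ∧ D * β = β * D ∧
  ∀ (i j : ZMod 2), ∀ x ∈ G i, ∀ y ∈ G j,
    D (br x y) = br (D x) ((α ^ s * β ^ r) y)
      + sg K (i * d) • br ((α ^ s * β ^ r) x) (D y)

/-- `D` is an `(α^s, β^r)`-derivation of degree `d` of the ternary bracket `br`. -/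
def IsAlphaBetaDeriv₃ (G : ZMod 2 → Submodule K V) (br : V → V → V → V)
    (α β : Module.End K V) (s r : ℕ) (d : ZMod 2) (D : Module.End K V) : Prop :=
  D * α = α * D ∧ D * β = β * D ∧
  ∀ (i j k : ZMod 2), ∀ x ∈ G i, ∀ y ∈ G j, ∀ z ∈ G k,
    D (br x y z) = br (D x) ((α ^ s * β ^ r) y) ((α ^ s * β ^ r) z)
      + sg K (i * d) • br ((α ^ s * β ^ r) x) (D y) ((α ^ s * β ^ r) z)
      + sg K (d * (i + j)) • br ((α ^ s * β ^ r) x) ((α ^ s * β ^ r) y) (D z)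

/-- An even super-skewsymmetric trilinear map with respect to the grading `G`
and the structure maps `α`, `β`. -/
structure IsEvenSkewTrilinear (G : ZMod 2 → Submodule K V)
    (α β : Module.End K V) (f : V → V → V → V) : Prop where
  trilinear : IsTrilinear K f
  even : ∀ (i j k : ZMod 2), ∀ x ∈ G i, ∀ y ∈ G j, ∀ z ∈ G k, f x y z ∈ G (i + j + k)
  skew₁ : ∀ (i j k : ZMod 2), ∀ x ∈ G i, ∀ y ∈ G j, ∀ z ∈ G k,
    f (β x) (β y) (α z) = - sg K (i * j) • f (β y) (β x) (α z)
  skew₂ : ∀ (i j k : ZMod 2), ∀ x ∈ G i, ∀ y ∈ G j, ∀ z ∈ G k,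
    f (β x) (β y) (α z) = - sg K (j * k) • f (β x) (β z) (α y)

/-- The composition `(f ∘_{α,β} g)(x₁∧x₂, y₁∧y₂, z)` of two trilinear maps,
for homogeneous `x₁, x₂, y₁, y₂` of degrees `a, b, c, d`. -/
def circ (α β : Module.End K V) (f g : V → V → V → V)
    (a b c d : ZMod 2) (x₁ x₂ y₁ y₂ z : V) : V :=
  f (g (β x₁) (β x₂) (α y₁)) (β (β y₂)) (β (β z))
    + sg K (c * (a + b)) • f (β (β y₁)) (g (β x₁) (β x₂) (α y₂)) (β (β z))
    - f (β (β x₁)) (β (β x₂)) (g (β y₁) (β y₂) (α z))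
    + sg K ((a + b) * (c + d)) • f (β (β y₁)) (β (β y₂)) (g (β x₁) (β x₂) (α z))


theorem sg_add (m n : ZMod 2) : sg K (m + n) = sg K m * sg K n := by
  have h : ∀ a : ZMod 2, a = 0 ∨ a = 1 := by decide
  rcases h m with rfl | rfl <;> rcases h n with rfl | rfl <;>
    simp [sg, CharTwo.add_self_eq_zero]

theorem sg_mul_self (n : ZMod 2) : sg K n * sg K n = 1 := by
  rw [← sg_add, CharTwo.add_self_eq_zero, sg, if_pos rfl]

/-- The induced ternary bracket `[·,·,·]_τ` satisfies the two
BiHom-skew-supersymmetry conditions. -/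
theorem induced_bracket_skew {K V : Type*} [Field K] [AddCommGroup V] [Module K V]
    (G : ZMod 2 → Submodule K V)
    (br : V → V → V) (α β : Module.End K V)
    (h : IsNonMultBiHomLieSuperalgebra K G br α β)
    (τ : V →ₗ[K] K) (hτ : TauCompatible K G br α β τ)
    (brτ : V → V → V → V) (hind : IsInducedBracket K G br τ brτ) :
    ∀ (i j k : ZMod 2), ∀ x₁ ∈ G i, ∀ x₂ ∈ G j, ∀ x₃ ∈ G k,
      brτ (β x₁) (β x₂) (α x₃) = - sg K (i * j) • brτ (β x₂) (β x₁) (α x₃)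
      ∧ brτ (β x₁) (β x₂) (α x₃) = - sg K (j * k) • brτ (β x₁) (β x₃) (α x₂) := by
  intro i j k x hx y hy z hz
  obtain ⟨-, -, -, hαβ⟩ := hτ
  obtain ⟨-, hbr⟩ := hind
  have swap (u v w : V) : τ (α w) • br u (β v) = τ (β w) • br u (α v) := by
    rw [← h.bilinear.smul_right, ← h.bilinear.smul_right, hαβ]
  have skew' (c : K) : (c * τ (α z)) • br (β x) (β y)
      = -sg K (i * j) • (c * τ (α z)) • br (β y) (β x) := by
    rw [mul_smul, mul_smul, swap, swap, h.skew i j x hx y hy]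
    module
  have hβx := h.beta_even i x hx
  have hβy := h.beta_even j y hy
  have hβz := h.beta_even k z hz
  have hαy := h.alpha_even j y hy
  have hαz := h.alpha_even k z hz
  rw [hbr i j k _ hβx _ hβy _ hαz]
  constructor
  · rw [hbr j i k _ hβy _ hβx _ hαz, skew', add_comm j i, mul_comm j i]
    linear_combination (norm := module) (-τ (β x) * sg_mul_self K (i * j)) • br (β y) (α z)
  · rw [hbr i k j _ hβx _ hβz _ hαy, mul_smul _ (τ (α z)), mul_smul _ (τ (α y)), swap, swap,
      h.skew j k y hy z hz, mul_add, mul_add, sg_add, sg_add, mul_comm k i, mul_comm k j,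
      mul_comm j i]
    linear_combination (norm := module)
      (sg K (i * j) * τ (β y) * sg_mul_self K (j * k)) • br (β x) (α z)

end BiHomLieSuper
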